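/- In a differential linear category, if a map s_R : !R → !R satisfies [ftc.2], then J_R is an isomorphism with inverse J_R⁻¹ = (m_R ⊗ 1_{!R})(s_R ⊗ 1_{!R}) m_{R,R}, and furthermore s_R = d°_R J_R⁻¹. -/

import Mathlib

universe u v

/-- A symmetric strict monoidal category (data and the coherence axioms that
do not require transport along object equalities). Composition `comp f g`
is in diagrammatic order: first `f`, then `g`. -/
structure SMCData where
  Obj : Type u
  Hom : Obj → Obj → Type v
  id : ∀ A : Obj, Hom A A
  comp : ∀ {A B C : Obj}, Hom A B → Hom B C → Hom A C
  id_comp : ∀ {A B : Obj} (f : Hom A B), comp (id A) f = f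
  comp_id : ∀ {A B : Obj} (f : Hom A B), comp f (id B) = f
  comp_assoc : ∀ {A B C D : Obj} (f : Hom A B) (g : Hom B C) (h : Hom C D),
    comp (comp f g) h = comp f (comp g h)
  ten : Obj → Obj → Obj
  unit : Obj
  tHom : ∀ {A B C D : Obj}, Hom A C → Hom B D → Hom (ten A B) (ten C D)
  tHom_id : ∀ (A B : Obj), tHom (id A) (id B) = id (ten A B)
  tHom_comp : ∀ {A₁ A₂ A₃ B₁ B₂ B₃ : Obj} (f : Hom A₁ A₂) (g : Hom A₂ A₃)
    (f' : Hom B₁ B₂) (g' : Hom B₂ B₃),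
    tHom (comp f g) (comp f' g') = comp (tHom f f') (tHom g g')
  tenAssoc : ∀ (A B C : Obj), ten (ten A B) C = ten A (ten B C)
  unit_ten : ∀ (A : Obj), ten unit A = A
  ten_unit : ∀ (A : Obj), ten A unit = A
  sw : ∀ (A B : Obj), Hom (ten A B) (ten B A)
  sw_natural : ∀ {A B C D : Obj} (f : Hom A C) (g : Hom B D),
    comp (tHom f g) (sw C D) = comp (sw A B) (tHom g f)
  sw_sw : ∀ (A B : Obj), comp (sw A B) (sw B A) = id (ten A B)

/-- The identity morphism transported along an equality of objects. In a
strict monoidal category the structural isomorphisms are identities, so these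
are used to express the strictness identifications. -/
def SMCData.cHom (C : SMCData) {A B : C.Obj} (h : A = B) : C.Hom A B := by
  cases h; exact C.id A
/-- A differential linear category: a differential category whose coalgebra modality is a monoidal coalgebra modality. -/
structure DiffLinCat extends SMCData where
  -- strictness coherence: associativity and unit identifications are
  -- (transported) identities compatible with the tensor of morphisms,
  -- and the symmetry satisfies the (strict) hexagon identity
  assoc_natural : ∀ {A₁ A₂ B₁ B₂ C₁ C₂ : Obj} (f : Hom A₁ A₂) (g : Hom B₁ B₂) (h : Hom C₁ C₂),
    comp (tHom (tHom f g) h) (toSMCData.cHom (tenAssoc A₂ B₂ C₂)) =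
      comp (toSMCData.cHom (tenAssoc A₁ B₁ C₁)) (tHom f (tHom g h))
  unit_ten_natural : ∀ {A B : Obj} (f : Hom A B),
    comp (tHom (id unit) f) (toSMCData.cHom (unit_ten B)) =
      comp (toSMCData.cHom (unit_ten A)) f
  ten_unit_natural : ∀ {A B : Obj} (f : Hom A B),
    comp (tHom f (id unit)) (toSMCData.cHom (ten_unit B)) =
      comp (toSMCData.cHom (ten_unit A)) f
  hexagon : ∀ (A B C : Obj),
    comp (toSMCData.cHom (tenAssoc A B C))
      (comp (tHom (id A) (sw B C))
        (comp (toSMCData.cHom (tenAssoc A C B).symm)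
          (comp (tHom (sw A C) (id B)) (toSMCData.cHom (tenAssoc C A B))))) =
      sw (ten A B) C
  -- additive enrichment: hom-sets are commutative monoids and composition
  -- and tensor preserve the additive structure
  add : ∀ {A B : Obj}, Hom A B → Hom A B → Hom A B
  zero : ∀ {A B : Obj}, Hom A B
  add_assoc : ∀ {A B : Obj} (f g h : Hom A B), add (add f g) h = add f (add g h)
  add_comm : ∀ {A B : Obj} (f g : Hom A B), add f g = add g f
  add_zero : ∀ {A B : Obj} (f : Hom A B), add f zero = f
  comp_add : ∀ {A B C : Obj} (f : Hom A B) (g h : Hom B C),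
    comp f (add g h) = add (comp f g) (comp f h)
  add_comp : ∀ {A B C : Obj} (f g : Hom A B) (h : Hom B C),
    comp (add f g) h = add (comp f h) (comp g h)
  comp_zero : ∀ {A B C : Obj} (f : Hom A B), comp f (zero : Hom B C) = zero
  zero_comp : ∀ {A B C : Obj} (f : Hom B C), comp (zero : Hom A B) f = zero
  tHom_add_left : ∀ {A B C D : Obj} (f g : Hom A C) (h : Hom B D),
    tHom (add f g) h = add (tHom f h) (tHom g h)
  tHom_add_right : ∀ {A B C D : Obj} (f : Hom A C) (g h : Hom B D),
    tHom f (add g h) = add (tHom f g) (tHom f h)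
  tHom_zero_left : ∀ {A B C D : Obj} (h : Hom B D),
    tHom (zero : Hom A C) h = zero
  tHom_zero_right : ∀ {A B C D : Obj} (f : Hom A C),
    tHom f (zero : Hom B D) = zero
  -- a coalgebra modality: a comonad (bang, rho, eps) with natural
  -- cocommutative comonoid structure (cmul, cunit) on each bang A,
  -- for which each rho A is a comonoid morphism
  bang : Obj → Obj
  bangMap : ∀ {A B : Obj}, Hom A B → Hom (bang A) (bang B)
  bangMap_id : ∀ (A : Obj), bangMap (id A) = id (bang A)
  bangMap_comp : ∀ {A B C : Obj} (f : Hom A B) (g : Hom B C),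
    bangMap (comp f g) = comp (bangMap f) (bangMap g)
  rho : ∀ (A : Obj), Hom (bang A) (bang (bang A))
  eps : ∀ (A : Obj), Hom (bang A) A
  cmul : ∀ (A : Obj), Hom (bang A) (ten (bang A) (bang A))
  cunit : ∀ (A : Obj), Hom (bang A) unit
  rho_natural : ∀ {A B : Obj} (f : Hom A B),
    comp (bangMap f) (rho B) = comp (rho A) (bangMap (bangMap f))
  eps_natural : ∀ {A B : Obj} (f : Hom A B),
    comp (bangMap f) (eps B) = comp (eps A) f
  cmul_natural : ∀ {A B : Obj} (f : Hom A B),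
    comp (bangMap f) (cmul B) = comp (cmul A) (tHom (bangMap f) (bangMap f))
  cunit_natural : ∀ {A B : Obj} (f : Hom A B),
    comp (bangMap f) (cunit B) = cunit A
  rho_eps : ∀ (A : Obj), comp (rho A) (eps (bang A)) = id (bang A)
  rho_bangMap_eps : ∀ (A : Obj), comp (rho A) (bangMap (eps A)) = id (bang A)
  rho_rho : ∀ (A : Obj), comp (rho A) (rho (bang A)) = comp (rho A) (bangMap (rho A))
  cmul_coassoc : ∀ (A : Obj),
    comp (cmul A) (comp (tHom (cmul A) (id (bang A)))
      (toSMCData.cHom (tenAssoc (bang A) (bang A) (bang A)))) =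
    comp (cmul A) (tHom (id (bang A)) (cmul A))
  cmul_counit_left : ∀ (A : Obj),
    comp (cmul A) (comp (tHom (cunit A) (id (bang A)))
      (toSMCData.cHom (unit_ten (bang A)))) = id (bang A)
  cmul_counit_right : ∀ (A : Obj),
    comp (cmul A) (comp (tHom (id (bang A)) (cunit A))
      (toSMCData.cHom (ten_unit (bang A)))) = id (bang A)
  cmul_cocomm : ∀ (A : Obj), comp (cmul A) (sw (bang A) (bang A)) = cmul A
  rho_cmul : ∀ (A : Obj),
    comp (rho A) (cmul (bang A)) = comp (cmul A) (tHom (rho A) (rho A))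
  rho_cunit : ∀ (A : Obj), comp (rho A) (cunit (bang A)) = cunit A
  -- a deriving transformation [d.1]-[d.5]
  der : ∀ (A : Obj), Hom (ten (bang A) A) (bang A)
  der_natural : ∀ {A B : Obj} (f : Hom A B),
    comp (tHom (bangMap f) f) (der B) = comp (der A) (bangMap f)
  -- [d.1] constant rule
  der_cunit : ∀ (A : Obj), comp (der A) (cunit A) = zero
  -- [d.2] Leibniz rule
  der_cmul : ∀ (A : Obj),
    comp (der A) (cmul A) =
      add
        (comp (tHom (cmul A) (id A))
          (comp (toSMCData.cHom (tenAssoc (bang A) (bang A) A))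
            (comp (tHom (id (bang A)) (sw (bang A) A))
              (comp (toSMCData.cHom (tenAssoc (bang A) A (bang A)).symm)
                (tHom (der A) (id (bang A)))))))
        (comp (tHom (cmul A) (id A))
          (comp (toSMCData.cHom (tenAssoc (bang A) (bang A) A))
            (tHom (id (bang A)) (der A))))
  -- [d.3] linear rule
  der_eps : ∀ (A : Obj),
    comp (der A) (eps A) = comp (tHom (cunit A) (id A)) (toSMCData.cHom (unit_ten A))
  -- [d.4] chain rule
  der_rho : ∀ (A : Obj),
    comp (der A) (rho A) =
      comp (tHom (cmul A) (id A))
        (comp (toSMCData.cHom (tenAssoc (bang A) (bang A) A))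
          (comp (tHom (rho A) (der A)) (der (bang A))))
  -- [d.5] interchange rule
  der_interchange : ∀ (A : Obj),
    comp (tHom (der A) (id A)) (der A) =
      comp (toSMCData.cHom (tenAssoc (bang A) A A))
        (comp (tHom (id (bang A)) (sw A A))
          (comp (toSMCData.cHom (tenAssoc (bang A) A A).symm)
            (comp (tHom (der A) (id A)) (der A))))
  -- monoidal coalgebra modality structure: (bang, m, mUnit) is a symmetric
  -- monoidal functor, rho, eps, cmul, cunit are monoidal transformations and
  -- cmul, cunit are bang-coalgebra morphisms
  m : ∀ (A B : Obj), Hom (ten (bang A) (bang B)) (bang (ten A B))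
  mUnit : Hom unit (bang unit)
  m_natural : ∀ {A A' B B' : Obj} (f : Hom A A') (g : Hom B B'),
    comp (tHom (bangMap f) (bangMap g)) (m A' B') = comp (m A B) (bangMap (tHom f g))
  m_assoc : ∀ (A B C : Obj),
    comp (tHom (m A B) (id (bang C)))
      (comp (m (ten A B) C) (bangMap (toSMCData.cHom (tenAssoc A B C)))) =
    comp (toSMCData.cHom (tenAssoc (bang A) (bang B) (bang C)))
      (comp (tHom (id (bang A)) (m B C)) (m A (ten B C)))
  m_unit_left : ∀ (A : Obj),
    comp (toSMCData.cHom (unit_ten (bang A)).symm)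
      (comp (tHom mUnit (id (bang A)))
        (comp (m unit A) (bangMap (toSMCData.cHom (unit_ten A))))) = id (bang A)
  m_unit_right : ∀ (A : Obj),
    comp (toSMCData.cHom (ten_unit (bang A)).symm)
      (comp (tHom (id (bang A)) mUnit)
        (comp (m A unit) (bangMap (toSMCData.cHom (ten_unit A))))) = id (bang A)
  m_sw : ∀ (A B : Obj),
    comp (sw (bang A) (bang B)) (m B A) = comp (m A B) (bangMap (sw A B))
  m_rho : ∀ (A B : Obj),
    comp (m A B) (rho (ten A B)) =
      comp (tHom (rho A) (rho B)) (comp (m (bang A) (bang B)) (bangMap (m A B)))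
  mUnit_rho : comp mUnit (rho unit) = comp mUnit (bangMap mUnit)
  m_eps : ∀ (A B : Obj), comp (m A B) (eps (ten A B)) = tHom (eps A) (eps B)
  mUnit_eps : comp mUnit (eps unit) = id unit
  m_cmul : ∀ (A B : Obj),
    comp (m A B) (cmul (ten A B)) =
      comp (tHom (cmul A) (cmul B))
        (comp (toSMCData.cHom (tenAssoc (bang A) (bang A) (ten (bang B) (bang B))))
          (comp (tHom (id (bang A)) (toSMCData.cHom (tenAssoc (bang A) (bang B) (bang B)).symm))
            (comp (tHom (id (bang A)) (tHom (sw (bang A) (bang B)) (id (bang B))))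
              (comp (tHom (id (bang A)) (toSMCData.cHom (tenAssoc (bang B) (bang A) (bang B))))
                (comp (toSMCData.cHom (tenAssoc (bang A) (bang B) (ten (bang A) (bang B))).symm)
                  (tHom (m A B) (m A B)))))))
  m_cunit : ∀ (A B : Obj),
    comp (m A B) (cunit (ten A B)) =
      comp (tHom (cunit A) (cunit B)) (toSMCData.cHom (unit_ten unit))
  mUnit_cmul : comp mUnit (cmul unit) =
    comp (toSMCData.cHom (unit_ten unit).symm) (tHom mUnit mUnit)
  mUnit_cunit : comp mUnit (cunit unit) = id unit
  cmul_coalg : ∀ (A : Obj),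
    comp (rho A) (bangMap (cmul A)) =
      comp (cmul A) (comp (tHom (rho A) (rho A)) (m (bang A) (bang A)))
  cunit_coalg : ∀ (A : Obj),
    comp (rho A) (bangMap (cunit A)) = comp (cunit A) mUnit

def DiffLinCat.cHom (C : DiffLinCat) {A B : C.Obj} (h : A = B) : C.Hom A B :=
  C.toSMCData.cHom h

namespace DiffLinCat

variable (C : DiffLinCat)

/-- The coderiving transformation d°_A := Δ_A (1 ⊗ ε_A). -/
def dcirc (A : C.Obj) : C.Hom (C.bang A) (C.ten (C.bang A) A) :=
  C.comp (C.cmul A) (C.tHom (C.id (C.bang A)) (C.eps A))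

/-- K_A := d°_A d_A + !(0). -/
def K (A : C.Obj) : C.Hom (C.bang A) (C.bang A) :=
  C.add (C.comp (C.dcirc A) (C.der A)) (C.bangMap (C.zero : C.Hom A A))

/-- J_A := d°_A d_A + 1_{!A}. -/
def J (A : C.Obj) : C.Hom (C.bang A) (C.bang A) :=
  C.add (C.comp (C.dcirc A) (C.der A)) (C.id (C.bang A))

/-- The deriving transformation at the monoidal unit, under the strictness
identification !R ⊗ R = !R. -/
def dR : C.Hom (C.bang C.unit) (C.bang C.unit) :=
  C.comp (C.cHom (C.ten_unit (C.bang C.unit)).symm) (C.der C.unit)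

/-- The coderiving transformation at the monoidal unit, under the strictness
identification !R ⊗ R = !R. -/
def dcircR : C.Hom (C.bang C.unit) (C.bang C.unit) :=
  C.comp (C.dcirc C.unit) (C.cHom (C.ten_unit (C.bang C.unit)))

end DiffLinCat

/-- The multiplication m_{R,R} : !R ⊗ !R → !R, under the strictness
identification R ⊗ R = R. -/
def DiffLinCat.mRR (C : DiffLinCat) :
    C.Hom (C.ten (C.bang C.unit) (C.bang C.unit)) (C.bang C.unit) :=
  C.comp (C.m C.unit C.unit) (C.bangMap (C.cHom (C.unit_ten C.unit)))

/-- The map m_{R,A} : !R ⊗ !A → !A, under the strictness identification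
R ⊗ A = A. -/
def DiffLinCat.mRA (C : DiffLinCat) (A : C.Obj) :
    C.Hom (C.ten (C.bang C.unit) (C.bang A)) (C.bang A) :=
  C.comp (C.m C.unit A) (C.bangMap (C.cHom (C.unit_ten A)))

open CategoryTheory MonoidalCategory

namespace SMCData

variable (C : SMCData.{u, v})

lemma cHom_comp_cHom {A B D : C.Obj} (h : A = B) (k : B = D) :
    C.comp (C.cHom h) (C.cHom k) = C.cHom (h.trans k) := by
  cases h; cases k; exact C.id_comp _

lemma tHom_cHom_cHom {A B D E : C.Obj} (h : A = B) (k : D = E) :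
    C.tHom (C.cHom h) (C.cHom k) = C.cHom (congrArg₂ C.ten h k) := by
  cases h; cases k; exact C.tHom_id _ _

end SMCData

namespace DiffLinCat

section Instances

variable (C : DiffLinCat.{v, u})

instance : Category.{v} C.Obj where
  Hom := C.Hom
  id := C.id
  comp := C.comp
  id_comp := C.id_comp
  comp_id := C.comp_id
  assoc := C.comp_assoc

/-- The isomorphism of `C` given by an equality of objects. -/
def cIso {A B : C.Obj} (h : A = B) : A ≅ B where
  hom := C.cHom h
  inv := C.cHom h.symm
  hom_inv_id := C.toSMCData.cHom_comp_cHom h h.symm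
  inv_hom_id := C.toSMCData.cHom_comp_cHom h.symm h

instance : MonoidalCategoryStruct C.Obj where
  tensorObj := C.ten
  tensorUnit := C.unit
  tensorHom := C.tHom
  whiskerLeft X _ _ f := C.tHom (C.id X) f
  whiskerRight f Y := C.tHom f (C.id Y)
  associator A B D := C.cIso (C.tenAssoc A B D)
  leftUnitor A := C.cIso (C.unit_ten A)
  rightUnitor A := C.cIso (C.ten_unit A)

instance : MonoidalCategory C.Obj :=
  MonoidalCategory.ofTensorHom
    (id_tensorHom_id := C.tHom_id)
    (id_tensorHom := fun _ _ _ _ => rfl)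
    (tensorHom_id := fun _ _ => rfl)
    (tensorHom_comp_tensorHom := fun f₁ f₂ g₁ g₂ => (C.tHom_comp f₁ g₁ f₂ g₂).symm)
    (associator_naturality := C.assoc_natural)
    (leftUnitor_naturality := C.unit_ten_natural)
    (rightUnitor_naturality := C.ten_unit_natural)
    (pentagon := fun W X Y Z => by
      change C.comp (C.tHom (C.toSMCData.cHom _) (C.toSMCData.cHom (rfl : Z = Z)))
        (C.comp (C.toSMCData.cHom _)
          (C.tHom (C.toSMCData.cHom (rfl : W = W)) (C.toSMCData.cHom _))) =
        C.comp (C.toSMCData.cHom _) (C.toSMCData.cHom _)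
      simp only [SMCData.tHom_cHom_cHom, SMCData.cHom_comp_cHom])
    (triangle := fun X Y => by
      change C.comp (C.toSMCData.cHom _)
          (C.tHom (C.toSMCData.cHom (rfl : X = X)) (C.toSMCData.cHom _)) =
        C.tHom (C.toSMCData.cHom _) (C.toSMCData.cHom (rfl : Y = Y))
      simp only [SMCData.tHom_cHom_cHom, SMCData.cHom_comp_cHom])

/-- The symmetry of `C` as an isomorphism. -/
def swIso (A B : C.Obj) : A ⊗ B ≅ B ⊗ A where
  hom := C.sw A B
  inv := C.sw B A
  hom_inv_id := C.sw_sw A B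
  inv_hom_id := C.sw_sw B A

lemma swIso_tensor_left (X Y Z : C.Obj) :
    (α_ X Y Z).inv ≫ (C.swIso (X ⊗ Y) Z).hom ≫ (α_ Z X Y).inv =
      X ◁ (C.swIso Y Z).hom ≫ (α_ X Z Y).inv ≫ (C.swIso X Z).hom ▷ Y := by
  have h : (α_ X Y Z).hom ≫ X ◁ (C.swIso Y Z).hom ≫ (α_ X Z Y).inv ≫
      (C.swIso X Z).hom ▷ Y ≫ (α_ Z X Y).hom = (C.swIso (X ⊗ Y) Z).hom := C.hexagon X Y Z
  rw [← h]
  simp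

instance : SymmetricCategory C.Obj where
  braiding := C.swIso
  braiding_naturality_right X _ _ f := C.sw_natural (C.id X) f
  braiding_naturality_left f Z := C.sw_natural f (C.id Z)
  hexagon_forward X Y Z := by
    have h : ((α_ Y Z X).inv ≫ (C.swIso (Y ⊗ Z) X).hom ≫ (α_ X Y Z).inv) ≫
        ((α_ X Y Z).hom ≫ (C.swIso X (Y ⊗ Z)).hom ≫ (α_ Y Z X).hom) = 𝟙 _ := by
      have := (C.swIso (Y ⊗ Z) X).hom_inv_id
      change _ ≫ (C.swIso X (Y ⊗ Z)).hom = _ at this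
      simp [reassoc_of% this]
    have k : (((C.swIso X Y).hom ▷ Z) ≫ (α_ Y X Z).hom ≫ (Y ◁ (C.swIso X Z).hom)) ≫
        (Y ◁ (C.swIso Z X).hom ≫ (α_ Y X Z).inv ≫ (C.swIso Y X).hom ▷ Z) = 𝟙 _ := by
      have h₁ : (C.swIso X Y).hom ▷ Z ≫ (C.swIso Y X).hom ▷ Z = 𝟙 _ :=
        hom_inv_whiskerRight (C.swIso X Y) Z
      have h₂ : Y ◁ (C.swIso X Z).hom ≫ Y ◁ (C.swIso Z X).hom = 𝟙 _ :=
        whiskerLeft_hom_inv Y (C.swIso X Z)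
      simp [reassoc_of% h₂, h₁]
    rw [swIso_tensor_left] at h
    rw [← Category.comp_id ((C.swIso X Y).hom ▷ Z ≫ _), ← h, ← Category.assoc (_ ▷ Z ≫ _), k,
      Category.id_comp]
  hexagon_reverse := C.swIso_tensor_left
  symmetry := C.sw_sw

instance (A B : C.Obj) : Add (A ⟶ B) := ⟨C.add⟩

instance (A B : C.Obj) : Zero (A ⟶ B) := ⟨C.zero⟩

instance (A B : C.Obj) : AddCommMonoid (A ⟶ B) where
  add_assoc := C.add_assoc
  add_comm := C.add_comm
  add_zero := C.add_zero
  zero_add f := (C.add_comm _ _).trans (C.add_zero f)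
  nsmul := nsmulRec

end Instances

section Structure

variable {C : DiffLinCat.{v, u}}

/-- The action of `!` on morphisms. -/
def bangHom {A B : C.Obj} (f : A ⟶ B) : C.bang A ⟶ C.bang B := C.bangMap f

/-- The comultiplication `!A ⟶ !!A` of the comonad. -/
def dig (A : C.Obj) : C.bang A ⟶ C.bang (C.bang A) := C.rho A

/-- The counit `!A ⟶ A` of the comonad. -/
def derel (A : C.Obj) : C.bang A ⟶ A := C.eps A

/-- The comultiplication `!A ⟶ !A ⊗ !A` of the comonoid `!A`. -/
def dup (A : C.Obj) : C.bang A ⟶ C.bang A ⊗ C.bang A := C.cmul A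

/-- The counit `!A ⟶ R` of the comonoid `!A`. -/
def del (A : C.Obj) : C.bang A ⟶ 𝟙_ C.Obj := C.cunit A

/-- The deriving transformation. -/
def diff (A : C.Obj) : C.bang A ⊗ A ⟶ C.bang A := C.der A

/-- The monoidal structure map `!A ⊗ !B ⟶ !(A ⊗ B)`. -/
def lax (A B : C.Obj) : C.bang A ⊗ C.bang B ⟶ C.bang (A ⊗ B) := C.m A B

variable (C) in
/-- The monoidal structure map `R ⟶ !R`. -/
def laxUnit : 𝟙_ C.Obj ⟶ C.bang (𝟙_ C.Obj) := C.mUnit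

section Additive

variable {A B D : C.Obj}

lemma comp_add' (f : A ⟶ B) (g h : B ⟶ D) : f ≫ (g + h) = f ≫ g + f ≫ h := C.comp_add f g h

lemma add_comp' (f g : A ⟶ B) (h : B ⟶ D) : (f + g) ≫ h = f ≫ h + g ≫ h := C.add_comp f g h

lemma comp_zero' (f : A ⟶ B) : f ≫ (0 : B ⟶ D) = 0 := C.comp_zero f

lemma zero_comp' (f : B ⟶ D) : (0 : A ⟶ B) ≫ f = 0 := C.zero_comp f

lemma add_whiskerRight (f g : A ⟶ B) : (f + g) ▷ D = f ▷ D + g ▷ D := C.tHom_add_left f g _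

lemma zero_tensorHom {E : C.Obj} (f : B ⟶ E) : (0 : A ⟶ D) ⊗ₘ f = 0 := C.tHom_zero_left f

lemma tensorHom_zero {E : C.Obj} (f : B ⟶ E) : f ⊗ₘ (0 : A ⟶ D) = 0 := C.tHom_zero_right f

lemma whiskerLeft_zero : D ◁ (0 : A ⟶ B) = 0 := C.tHom_zero_right _

end Additive

section Axioms

variable {A B : C.Obj}

lemma bangHom_comp {D : C.Obj} (f : A ⟶ B) (g : B ⟶ D) :
    bangHom (f ≫ g) = bangHom f ≫ bangHom g := C.bangMap_comp f g

lemma derel_naturality (f : A ⟶ B) : bangHom f ≫ derel B = derel A ≫ f := C.eps_natural f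

lemma dup_naturality (f : A ⟶ B) :
    bangHom f ≫ dup B = dup A ≫ (bangHom f ⊗ₘ bangHom f) := C.cmul_natural f

lemma dig_bangHom_derel (A : C.Obj) : dig A ≫ bangHom (derel A) = 𝟙 _ := C.rho_bangMap_eps A

lemma dup_assoc (A : C.Obj) :
    dup A ≫ dup A ▷ C.bang A ≫ (α_ _ _ _).hom = dup A ≫ C.bang A ◁ dup A := C.cmul_coassoc A

lemma del_dup (A : C.Obj) : dup A ≫ del A ▷ C.bang A ≫ (λ_ _).hom = 𝟙 _ := C.cmul_counit_left A

lemma dup_del (A : C.Obj) : dup A ≫ C.bang A ◁ del A ≫ (ρ_ _).hom = 𝟙 _ := C.cmul_counit_right A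

lemma dig_dup (A : C.Obj) : dig A ≫ dup (C.bang A) = dup A ≫ (dig A ⊗ₘ dig A) := C.rho_cmul A

lemma diff_naturality (f : A ⟶ B) :
    (bangHom f ⊗ₘ f) ≫ diff B = diff A ≫ bangHom f := C.der_natural f

lemma diff_del (A : C.Obj) : diff A ≫ del A = 0 := C.der_cunit A

lemma diff_dup (A : C.Obj) :
    diff A ≫ dup A =
      dup A ▷ A ≫ (α_ _ _ _).hom ≫ C.bang A ◁ (β_ (C.bang A) A).hom ≫ (α_ _ _ _).inv ≫
        diff A ▷ C.bang A +
      dup A ▷ A ≫ (α_ _ _ _).hom ≫ C.bang A ◁ diff A := C.der_cmul A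

lemma diff_derel (A : C.Obj) : diff A ≫ derel A = del A ▷ A ≫ (λ_ A).hom := C.der_eps A

lemma diff_dig (A : C.Obj) :
    diff A ≫ dig A =
      dup A ▷ A ≫ (α_ _ _ _).hom ≫ (dig A ⊗ₘ diff A) ≫ diff (C.bang A) := C.der_rho A

lemma lax_naturality {A' B' : C.Obj} (f : A ⟶ A') (g : B ⟶ B') :
    (bangHom f ⊗ₘ bangHom g) ≫ lax A' B' = lax A B ≫ bangHom (f ⊗ₘ g) := C.m_natural f g

lemma lax_leftUnitor (A : C.Obj) :
    (λ_ _).inv ≫ laxUnit C ▷ C.bang A ≫ lax (𝟙_ _) A ≫ bangHom (λ_ A).hom = 𝟙 _ := C.m_unit_left A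

lemma lax_rightUnitor (A : C.Obj) :
    (ρ_ _).inv ≫ C.bang A ◁ laxUnit C ≫ lax A (𝟙_ _) ≫ bangHom (ρ_ A).hom = 𝟙 _ :=
  C.m_unit_right A

lemma braiding_lax (A B : C.Obj) :
    (β_ _ _).hom ≫ lax B A = lax A B ≫ bangHom (β_ A B).hom := C.m_sw A B

lemma lax_derel (A B : C.Obj) : lax A B ≫ derel (A ⊗ B) = derel A ⊗ₘ derel B := C.m_eps A B

lemma laxUnit_derel : laxUnit C ≫ derel (𝟙_ _) = 𝟙 _ := C.mUnit_eps

lemma lax_dup (A B : C.Obj) :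
    lax A B ≫ dup (A ⊗ B) =
      (dup A ⊗ₘ dup B) ≫ tensorμ _ _ _ _ ≫ (lax A B ⊗ₘ lax A B) := by
  simp only [tensorμ, Category.assoc]
  exact C.m_cmul A B

lemma laxUnit_dup : laxUnit C ≫ dup (𝟙_ _) = (λ_ _).inv ≫ (laxUnit C ⊗ₘ laxUnit C) := C.mUnit_cmul

lemma laxUnit_del : laxUnit C ≫ del (𝟙_ _) = 𝟙 _ := C.mUnit_cunit

lemma dig_bangHom_dup (A : C.Obj) :
    dig A ≫ bangHom (dup A) = dup A ≫ (dig A ⊗ₘ dig A) ≫ lax _ _ := C.cmul_coalg A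

lemma dig_bangHom_del (A : C.Obj) : dig A ≫ bangHom (del A) = del A ≫ laxUnit C := C.cunit_coalg A

end Axioms

section DirectionalDerivative

variable {Y : C.Obj}

/-- The derivative on `!Y` in the direction of a point `w` of `Y`. -/
def dirDeriv (w : 𝟙_ C.Obj ⟶ Y) : C.bang Y ⟶ C.bang Y :=
  (ρ_ _).inv ≫ C.bang Y ◁ w ≫ diff Y

lemma dirDeriv_zero : dirDeriv (0 : 𝟙_ C.Obj ⟶ Y) = 0 := by
  simp [dirDeriv, whiskerLeft_zero, zero_comp', comp_zero']

lemma dirDeriv_bangHom {A : C.Obj} (w : 𝟙_ C.Obj ⟶ Y) (f : Y ⟶ A) :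
    dirDeriv w ≫ bangHom f = bangHom f ≫ dirDeriv (w ≫ f) := by
  simp only [dirDeriv, Category.assoc, ← diff_naturality, tensorHom_def', whiskerLeft_comp,
    whisker_exchange_assoc]
  simp

lemma dirDeriv_derel (w : 𝟙_ C.Obj ⟶ Y) : dirDeriv w ≫ derel Y = del Y ≫ w := by
  simp only [dirDeriv, Category.assoc, diff_derel, whisker_exchange_assoc]
  simp [← unitors_inv_equal]

lemma dirDeriv_del (w : 𝟙_ C.Obj ⟶ Y) : dirDeriv w ≫ del Y = 0 := by
  simp only [dirDeriv, Category.assoc, diff_del, comp_zero']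

lemma dirDeriv_dup (w : 𝟙_ C.Obj ⟶ Y) :
    dirDeriv w ≫ dup Y = dup Y ≫ dirDeriv w ▷ C.bang Y + dup Y ≫ C.bang Y ◁ dirDeriv w := by
  have h₁ : (ρ_ _).inv ≫ C.bang Y ◁ w ≫ dup Y ▷ Y ≫ (α_ _ _ _).hom ≫
      C.bang Y ◁ (β_ (C.bang Y) Y).hom ≫ (α_ _ _ _).inv ≫ diff Y ▷ C.bang Y =
      dup Y ≫ dirDeriv w ▷ C.bang Y := by
    simp only [dirDeriv, whisker_exchange_assoc, tensor_whiskerLeft, Category.assoc,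
      Iso.inv_hom_id_assoc, ← whiskerLeft_comp_assoc, BraidedCategory.braiding_naturality_right]
    simp
  have h₂ : (ρ_ _).inv ≫ C.bang Y ◁ w ≫ dup Y ▷ Y ≫ (α_ _ _ _).hom ≫ C.bang Y ◁ diff Y =
      dup Y ≫ C.bang Y ◁ dirDeriv w := by
    simp only [dirDeriv, whisker_exchange_assoc, tensor_whiskerLeft, Category.assoc,
      Iso.inv_hom_id_assoc]
    simp
  simp only [dirDeriv, Category.assoc, diff_dup, comp_add']
  simpa only [dirDeriv] using congrArg₂ (· + ·) h₁ h₂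

lemma dirDeriv_dig_bangHom {A : C.Obj} (w : 𝟙_ C.Obj ⟶ Y) (h : C.bang Y ⟶ A) :
    dirDeriv w ≫ dig Y ≫ bangHom h =
      dup Y ≫ ((dig Y ≫ bangHom h) ⊗ₘ (dirDeriv w ≫ h)) ≫ diff A := by
  simp only [dirDeriv, Category.assoc, reassoc_of% diff_dig, ← diff_naturality,
    whisker_exchange_assoc, tensor_whiskerLeft, Iso.inv_hom_id_assoc,
    tensorHom_comp_tensorHom_assoc]
  simp [tensorHom_def']

end DirectionalDerivative

section Unit

variable (C) in
/-- The deriving transformation at the monoidal unit. -/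
def unitDiff : C.bang (𝟙_ C.Obj) ⟶ C.bang (𝟙_ C.Obj) := dirDeriv (𝟙 _)

variable (C) in
/-- The coderiving transformation at the monoidal unit. -/
def unitCodiff : C.bang (𝟙_ C.Obj) ⟶ C.bang (𝟙_ C.Obj) :=
  dup _ ≫ C.bang (𝟙_ C.Obj) ◁ derel _ ≫ (ρ_ _).hom

variable (C) in
/-- The multiplication `!R ⊗ !R ⟶ !R`. -/
def unitMul : C.bang (𝟙_ C.Obj) ⊗ C.bang (𝟙_ C.Obj) ⟶ C.bang (𝟙_ C.Obj) :=
  lax _ _ ≫ bangHom (λ_ _).hom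

lemma unitDiff_unitCodiff :
    unitDiff C ≫ unitCodiff C = unitCodiff C ≫ unitDiff C + 𝟙 _ := by
  have h : unitDiff C ≫ derel _ = del _ := by simp [unitDiff, dirDeriv_derel]
  have h' := dirDeriv_dup (𝟙 (𝟙_ C.Obj))
  rw [← unitDiff] at h'
  simp only [unitCodiff, reassoc_of% h', add_comp', Category.assoc, ← whiskerLeft_comp_assoc, h,
    dup_del, ← whisker_exchange_assoc, rightUnitor_naturality]

lemma bangHom_zero_unitCodiff : bangHom (0 : 𝟙_ C.Obj ⟶ 𝟙_ C.Obj) ≫ unitCodiff C = 0 := by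
  simp only [unitCodiff, reassoc_of% dup_naturality, MonoidalCategory.tensorHom_def, Category.assoc,
    ← whiskerLeft_comp_assoc, derel_naturality, comp_zero', whiskerLeft_zero, zero_comp']

lemma laxUnit_unitCodiff : laxUnit C ≫ unitCodiff C = laxUnit C := by
  simp only [unitCodiff, reassoc_of% laxUnit_dup (C := C),
    MonoidalCategory.tensorHom_def, Category.assoc, ← whiskerLeft_comp_assoc, laxUnit_derel]
  simp [unitors_inv_equal]

lemma unitMul_unitCodiff :
    unitMul C ≫ unitCodiff C = (unitCodiff C ⊗ₘ unitCodiff C) ≫ unitMul C := by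
  have h : unitMul C ≫ dup _ ≫ _ ◁ derel _ =
      (dup _ ⊗ₘ dup _) ≫ (_ ◁ derel _ ⊗ₘ _ ◁ derel _) ≫ tensorμ _ _ _ _ ≫
        (unitMul C ⊗ₘ (λ_ _).hom) := by
    simp only [← id_tensorHom, tensorμ_natural_assoc, unitMul, Category.assoc,
      reassoc_of% dup_naturality, reassoc_of% lax_dup, tensorHom_comp_tensorHom,
      derel_naturality, reassoc_of% lax_derel, Category.comp_id, Category.id_comp,
      id_tensorHom_id]
  have h' : tensorμ _ _ _ _ ≫ (unitMul C ⊗ₘ (λ_ _).hom) ≫ (ρ_ _).hom =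
      ((ρ_ _).hom ⊗ₘ (ρ_ _).hom) ≫ unitMul C := by
    rw [rightUnitor_monoidal, tensorHom_def']
    simp only [Category.assoc, rightUnitor_naturality]
  simp only [unitCodiff, reassoc_of% h, h', tensorHom_comp_tensorHom_assoc]

lemma braiding_unitMul : (β_ _ _).hom ≫ unitMul C = unitMul C := by
  simp only [unitMul, reassoc_of% braiding_lax, ← bangHom_comp]
  rw [braiding_leftUnitor, unitors_equal]

/-- A pair of functionals on `Y` induces a map `!Y ⟶ !R`, multiplying the two functionals. -/
lemma dup_bangHom_unitMul {Y : C.Obj} (p q : Y ⟶ 𝟙_ C.Obj) :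
    dup Y ≫ (bangHom p ⊗ₘ bangHom q) ≫ unitMul C =
      dig Y ≫ bangHom (dup Y ≫ ((derel Y ≫ p) ⊗ₘ (derel Y ≫ q)) ≫ (λ_ _).hom) := by
  simp only [unitMul, bangHom_comp, reassoc_of% dig_bangHom_dup, ← reassoc_of% lax_naturality,
    tensorHom_comp_tensorHom_assoc, reassoc_of% dig_bangHom_derel]

lemma dirDeriv_dup_bangHom_unitMul {Y : C.Obj} {p q : Y ⟶ 𝟙_ C.Obj} {w : 𝟙_ C.Obj ⟶ Y}
    (hp : w ≫ p = 𝟙 _) (hq : w ≫ q = 0) :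
    dup Y ≫ (bangHom p ⊗ₘ bangHom q) ≫ unitDiff C ▷ _ ≫ unitMul C =
      dup Y ≫ (bangHom p ⊗ₘ bangHom q) ≫ _ ◁ unitCodiff C ≫ unitMul C ≫ unitDiff C := by
  have h₁ : dirDeriv w ≫ dup Y ≫ (bangHom p ⊗ₘ bangHom q) =
      dup Y ≫ (bangHom p ⊗ₘ bangHom q) ≫ unitDiff C ▷ _ := by
    simp only [reassoc_of% dirDeriv_dup, add_comp', Category.assoc, ← tensorHom_id,
      ← id_tensorHom, tensorHom_comp_tensorHom, Category.id_comp, Category.comp_id,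
      dirDeriv_bangHom, hp, hq, dirDeriv_zero, comp_zero', tensorHom_zero,
      _root_.add_zero, unitDiff]
  have h₂ : dirDeriv w ≫ dup Y ≫ ((derel Y ≫ p) ⊗ₘ (derel Y ≫ q)) ≫ (λ_ _).hom =
      derel Y ≫ q := by
    simp only [reassoc_of% dirDeriv_dup, add_comp', Category.assoc, ← tensorHom_id,
      ← id_tensorHom, tensorHom_comp_tensorHom_assoc, Category.id_comp,
      reassoc_of% dirDeriv_derel, hp, hq, comp_zero', tensorHom_zero, zero_comp', _root_.add_zero,
      Category.comp_id]
    rw [MonoidalCategory.tensorHom_def, Category.assoc, leftUnitor_naturality,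
      reassoc_of% del_dup]
  have h₃ : dup Y ≫ ((dup Y ≫ (bangHom p ⊗ₘ bangHom q) ≫ unitMul C) ⊗ₘ
      (bangHom q ≫ derel _)) ≫ (ρ_ _).hom =
      dup Y ≫ (bangHom p ⊗ₘ bangHom q) ≫ _ ◁ unitCodiff C ≫ unitMul C := by
    have hα : ((bangHom p ⊗ₘ bangHom q) ⊗ₘ bangHom q) ≫ _ ◁ derel _ ≫ (ρ_ _).hom =
        (α_ _ _ _).hom ≫ (bangHom p ⊗ₘ (bangHom q ⊗ₘ bangHom q)) ≫ _ ◁ _ ◁ derel _ ≫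
          _ ◁ (ρ_ _).hom := by
      rw [← associator_naturality_assoc]
      simp
    have hq' : (bangHom p ⊗ₘ bangHom q) ≫ _ ◁ dup _ =
        _ ◁ dup Y ≫ (bangHom p ⊗ₘ (bangHom q ⊗ₘ bangHom q)) := by
      simp only [← id_tensorHom, tensorHom_comp_tensorHom, dup_naturality, Category.comp_id,
        Category.id_comp]
    have hl : ((dup Y ≫ (bangHom p ⊗ₘ bangHom q) ≫ unitMul C) ⊗ₘ (bangHom q ≫ derel _)) ≫
        (ρ_ _).hom = dup Y ▷ _ ≫ ((bangHom p ⊗ₘ bangHom q) ⊗ₘ bangHom q) ≫ _ ◁ derel _ ≫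
          (ρ_ _).hom ≫ unitMul C := by
      rw [← rightUnitor_naturality]
      simp only [← id_tensorHom, ← tensorHom_id, tensorHom_comp_tensorHom_assoc,
        Category.comp_id, Category.id_comp]
    simp only [unitCodiff, whiskerLeft_comp, Category.assoc, hl, reassoc_of% hα, reassoc_of% hq',
      reassoc_of% dup_assoc]
  rw [← reassoc_of% h₁, dup_bangHom_unitMul, dirDeriv_dig_bangHom, h₂, ← dup_bangHom_unitMul,
    ← derel_naturality, ← reassoc_of% h₃]
  simp [unitDiff, dirDeriv]

lemma exists_pairing : ∃ (Y : C.Obj) (p q : Y ⟶ 𝟙_ C.Obj) (w : 𝟙_ C.Obj ⟶ Y)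
    (y : C.bang (𝟙_ C.Obj) ⊗ C.bang (𝟙_ C.Obj) ⟶ C.bang Y),
    w ≫ p = 𝟙 _ ∧ w ≫ q = 0 ∧ y ≫ dup Y ≫ (bangHom p ⊗ₘ bangHom q) = 𝟙 _ := by
  refine ⟨C.bang (𝟙_ _) ⊗ C.bang (𝟙_ _), (derel _ ⊗ₘ del _) ≫ (ρ_ _).hom,
    (del _ ⊗ₘ derel _) ≫ (λ_ _).hom, (λ_ _).inv ≫ ((laxUnit C ≫ unitDiff C) ⊗ₘ laxUnit C),
    (dig _ ⊗ₘ dig _) ≫ lax _ _, ?_, ?_, ?_⟩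
  · simp [unitDiff, dirDeriv_derel, laxUnit_del, unitors_inv_equal]
  · simp [unitDiff, dirDeriv_del, comp_zero', zero_comp', zero_tensorHom]
  · have hp : (dig _ ⊗ₘ dig (𝟙_ _)) ≫ lax _ _ ≫
        bangHom ((derel _ ⊗ₘ del _) ≫ (ρ_ (𝟙_ C.Obj)).hom) =
        (𝟙 _ ⊗ₘ del _) ≫ (ρ_ (C.bang (𝟙_ C.Obj))).hom := by
      have h := lax_rightUnitor (𝟙_ C.Obj)
      rw [Iso.inv_comp_eq, Category.comp_id] at h
      rw [bangHom_comp, ← reassoc_of% lax_naturality, tensorHom_comp_tensorHom_assoc,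
        dig_bangHom_derel, dig_bangHom_del, ← h]
      simp
    have hq : (dig _ ⊗ₘ dig (𝟙_ _)) ≫ lax _ _ ≫
        bangHom ((del (𝟙_ _) ⊗ₘ derel _) ≫ (λ_ (𝟙_ C.Obj)).hom) =
        (del _ ⊗ₘ 𝟙 _) ≫ (λ_ (C.bang (𝟙_ C.Obj))).hom := by
      have h := lax_leftUnitor (𝟙_ C.Obj)
      rw [Iso.inv_comp_eq, Category.comp_id] at h
      rw [bangHom_comp, ← reassoc_of% lax_naturality, tensorHom_comp_tensorHom_assoc,
        dig_bangHom_derel, dig_bangHom_del, ← h]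
      simp
    have hμ : tensorμ (C.bang (𝟙_ C.Obj)) (𝟙_ _) (𝟙_ _) (C.bang (𝟙_ C.Obj)) ≫
        ((ρ_ _).hom ⊗ₘ (λ_ _).hom) = (ρ_ _).hom ⊗ₘ (λ_ _).hom := by
      simp only [tensorμ, braiding_tensorUnit_left]
      monoidal
    simp only [Category.assoc, reassoc_of% lax_dup, tensorHom_comp_tensorHom,
      tensorHom_comp_tensorHom_assoc, dig_dup]
    simp only [← tensorHom_comp_tensorHom, Category.assoc, tensorμ_natural_assoc]
    simp only [tensorHom_comp_tensorHom, hp, hq]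
    simp only [← tensorHom_comp_tensorHom, ← tensorμ_natural_assoc, hμ]
    simp only [tensorHom_comp_tensorHom, id_tensorHom, tensorHom_id, dup_del, del_dup,
      id_whiskerRight]

lemma unitDiff_whiskerRight_unitMul :
    unitDiff C ▷ _ ≫ unitMul C = _ ◁ unitCodiff C ≫ unitMul C ≫ unitDiff C := by
  obtain ⟨Y, p, q, w, y, hp, hq, hy⟩ := exists_pairing (C := C)
  have := y ≫= dirDeriv_dup_bangHom_unitMul hp hq
  simpa only [reassoc_of% hy] using this

lemma whiskerLeft_unitDiff_unitMul :
    _ ◁ unitDiff C ≫ unitMul C = unitCodiff C ▷ _ ≫ unitMul C ≫ unitDiff C := by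
  rw [← braiding_unitMul, BraidedCategory.braiding_naturality_right_assoc,
    unitDiff_whiskerRight_unitMul, Category.assoc,
    BraidedCategory.braiding_naturality_left_assoc]

end Unit

section Inverse

variable {s : C.bang (𝟙_ C.Obj) ⟶ C.bang (𝟙_ C.Obj)}

/-- Scaling by a generalised point `t` of `!R`. -/
def scale (t : 𝟙_ C.Obj ⟶ C.bang (𝟙_ C.Obj)) : C.bang (𝟙_ C.Obj) ⟶ C.bang (𝟙_ C.Obj) :=
  (λ_ _).inv ≫ t ▷ _ ≫ unitMul C

lemma scale_laxUnit : scale (laxUnit C) = 𝟙 _ := lax_leftUnitor (𝟙_ C.Obj)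

lemma scale_add (t t' : 𝟙_ C.Obj ⟶ C.bang (𝟙_ C.Obj)) :
    scale (t + t') = scale t + scale t' := by
  simp only [scale, add_whiskerRight, add_comp', comp_add']

lemma scale_unitCodiff_unitDiff (t : 𝟙_ C.Obj ⟶ C.bang (𝟙_ C.Obj)) :
    scale t ≫ unitCodiff C ≫ unitDiff C = scale (t ≫ unitCodiff C ≫ unitDiff C) := by
  simp only [scale, Category.assoc, reassoc_of% unitMul_unitCodiff (C := C),
    MonoidalCategory.tensorHom_def, ← unitDiff_whiskerRight_unitMul, comp_whiskerRight]

lemma unitCodiff_unitDiff_scale (t : 𝟙_ C.Obj ⟶ C.bang (𝟙_ C.Obj)) :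
    unitCodiff C ≫ unitDiff C ≫ scale t = scale t ≫ unitCodiff C ≫ unitDiff C := by
  simp only [scale, Category.assoc, reassoc_of% unitMul_unitCodiff (C := C),
    leftUnitor_inv_naturality_assoc, whisker_exchange_assoc, whiskerLeft_unitDiff_unitMul,
    tensorHom_def']

/-- If `s` satisfies the second fundamental theorem of calculus at `R`, then `s` followed by `J_R`
is the coderiving transformation. -/
lemma comp_J_eq_unitCodiff (hs : s ≫ unitDiff C + bangHom 0 = 𝟙 _) :
    s ≫ (unitCodiff C ≫ unitDiff C + 𝟙 _) = unitCodiff C := by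
  have h := congrArg (· ≫ unitCodiff C) hs
  simpa only [add_comp', Category.assoc, unitDiff_unitCodiff, bangHom_zero_unitCodiff,
    _root_.add_zero, Category.id_comp] using h

lemma scale_comp_J (hs : s ≫ unitDiff C + bangHom 0 = 𝟙 _) :
    scale (laxUnit C ≫ s) ≫ (unitCodiff C ≫ unitDiff C + 𝟙 _) = 𝟙 _ := by
  rw [comp_add', scale_unitCodiff_unitDiff, Category.comp_id, ← scale_add,
    ← Category.comp_id (laxUnit C ≫ s), Category.assoc, Category.assoc, Category.assoc,
    Category.id_comp, ← comp_add', ← comp_add', comp_J_eq_unitCodiff hs, laxUnit_unitCodiff,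
    scale_laxUnit]

lemma J_comp_scale (hs : s ≫ unitDiff C + bangHom 0 = 𝟙 _) :
    (unitCodiff C ≫ unitDiff C + 𝟙 _) ≫ scale (laxUnit C ≫ s) = 𝟙 _ := by
  rw [add_comp', Category.assoc, unitCodiff_unitDiff_scale, Category.id_comp,
    ← scale_comp_J hs, comp_add', Category.comp_id]

end Inverse

lemma dR_eq_unitDiff : C.dR = unitDiff C := by
  simp only [unitDiff, dirDeriv, whiskerLeft_id, Category.id_comp]
  rfl

lemma dcircR_eq_unitCodiff : C.dcircR = unitCodiff C :=
  C.comp_assoc _ _ _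

lemma J_unit_eq : C.J C.unit = unitCodiff C ≫ unitDiff C + 𝟙 _ := by
  have h : unitCodiff C ≫ unitDiff C = (dup _ ≫ _ ◁ derel _) ≫ diff _ := by
    simp [unitCodiff, unitDiff, dirDeriv]
  rw [h]
  rfl

lemma scale_laxUnit_comp (s : C.bang (𝟙_ C.Obj) ⟶ C.bang (𝟙_ C.Obj)) :
    C.comp (C.cHom (C.unit_ten (C.bang C.unit)).symm)
      (C.comp (C.tHom C.mUnit (C.id (C.bang C.unit)))
        (C.comp (C.tHom s (C.id (C.bang C.unit))) C.mRR)) = scale (laxUnit C ≫ s) := by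
  simp only [scale, comp_whiskerRight, Category.assoc]
  rfl

end Structure

end DiffLinCat

/-- Lemma: in a differential linear category, if s_R satisfies [ftc.2]
then J_R is an isomorphism with inverse
J_R⁻¹ = (m_R ⊗ 1_{!R})(s_R ⊗ 1_{!R}) m_{R,R}, and s_R = d°_R J_R⁻¹. -/
theorem statement12 (C : DiffLinCat) (sR : C.Hom (C.bang C.unit) (C.bang C.unit))
    (hftc2 : C.add (C.comp sR C.dR) (C.bangMap (C.zero : C.Hom C.unit C.unit)) =
      C.id (C.bang C.unit)) :
    (C.comp (C.J C.unit)
        (C.comp (C.cHom (C.unit_ten (C.bang C.unit)).symm)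
          (C.comp (C.tHom C.mUnit (C.id (C.bang C.unit)))
            (C.comp (C.tHom sR (C.id (C.bang C.unit))) C.mRR))) =
      C.id (C.bang C.unit)) ∧
    (C.comp
        (C.comp (C.cHom (C.unit_ten (C.bang C.unit)).symm)
          (C.comp (C.tHom C.mUnit (C.id (C.bang C.unit)))
            (C.comp (C.tHom sR (C.id (C.bang C.unit))) C.mRR)))
        (C.J C.unit) =
      C.id (C.bang C.unit)) ∧
    (sR = C.comp C.dcircR
        (C.comp (C.cHom (C.unit_ten (C.bang C.unit)).symm)
          (C.comp (C.tHom C.mUnit (C.id (C.bang C.unit)))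
            (C.comp (C.tHom sR (C.id (C.bang C.unit))) C.mRR)))) := by
  have hs : sR ≫ DiffLinCat.unitDiff C + DiffLinCat.bangHom 0 = 𝟙 _ := by
    rw [← DiffLinCat.dR_eq_unitDiff]
    exact hftc2
  rw [DiffLinCat.scale_laxUnit_comp, DiffLinCat.J_unit_eq, DiffLinCat.dcircR_eq_unitCodiff]
  refine ⟨DiffLinCat.J_comp_scale hs, DiffLinCat.scale_comp_J hs, ?_⟩
  have h := DiffLinCat.comp_J_eq_unitCodiff hs =≫ DiffLinCat.scale (DiffLinCat.laxUnit C ≫ sR)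
  rw [Category.assoc, DiffLinCat.J_comp_scale hs, Category.comp_id] at h
  exact h
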